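/- Let X be an n×d real matrix partitioned into columns in a subset k (giving X_k) and its complement (giving X_{−k}), with, for every i, the leave-one-out Gram matrix G_i = X_{−i,k}ᵀ X_{−i,k} positive definite (X_{−i,k} being X_k with row i deleted). For each i define v(i) ∈ ℝⁿ by v(i)_j = X_{j,k} G_i^{-1} X_{i,k}ᵀ, let P̃ be the n×n matrix with P̃_{ii} = −1 and P̃_{ij} = v(i)_j for j ≠ i, and let D̃ be diagonal with D̃_{ii} = (v(i)_i + 1)^{-1}. Let τ > 0, β ∈ ℝ^d with β_{−k} its restriction to the complementary columns, ŷ = X_{−k} β_{−k}, ε ∈ ℝⁿ, y = Xβ + ε. Then Σ_{i=1}^n ( −( y_i − Σ_{j ≠ i} v(i)_j y_j )² / (2(v(i)_i + 1)τ²) − (1/2)·log(2π (v(i)_i + 1) τ²) ) = εᵀÃε + b̃ᵀε + c̃, where Ã = −(1/(2τ²)) P̃ᵀ D̃ P̃, b̃ = −(1/τ²) P̃ᵀ D̃ P̃ ŷ, and c̃ = −(1/(2τ²)) ŷᵀ P̃ᵀ D̃ P̃ ŷ + (1/2)·Σ_{i=1}^n log D̃_{ii} − (n/2)·log(2πτ²).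 -/

import Mathlib

open MeasureTheory Real Matrix

/-- The bilinear form of `Pᵀ * diagonal D * P` is a weighted sum over the rows of `P`. -/
lemma dotProduct_transpose_mul_diagonal_mul_mulVec {n : ℕ} (P : Matrix (Fin n) (Fin n) ℝ)
    (D x z : Fin n → ℝ) :
    x ⬝ᵥ (Pᵀ * Matrix.diagonal D * P).mulVec z
      = ∑ i, D i * (P.mulVec x i * P.mulVec z i) := by
  rw [← Matrix.mulVec_mulVec, ← Matrix.mulVec_mulVec, Matrix.dotProduct_mulVec,
    Matrix.vecMul_transpose]
  simp only [dotProduct, Matrix.mulVec_diagonal]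
  exact Finset.sum_congr rfl fun i _ => by ring

/-- The leave-one-out weights reproduce every linear function of the covariates. -/
lemma sum_erase_leverage_mul_dotProduct {n m : ℕ} (A : Matrix (Fin n) (Fin m) ℝ) (i : Fin n)
    (G : Matrix (Fin m) (Fin m) ℝ)
    (hG : G = ∑ p ∈ Finset.univ.erase i, Matrix.vecMulVec (A p) (A p))
    (hdet : IsUnit G.det) (γ : Fin m → ℝ) :
    ∑ j ∈ Finset.univ.erase i, (A j ⬝ᵥ G⁻¹.mulVec (A i)) * (A j ⬝ᵥ γ) = A i ⬝ᵥ γ := by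
  have key (w : Fin m → ℝ) :
      ∑ j ∈ Finset.univ.erase i, (A j ⬝ᵥ w) * (A j ⬝ᵥ γ) = G.mulVec w ⬝ᵥ γ := by
    rw [hG, Matrix.sum_mulVec, sum_dotProduct]
    refine Finset.sum_congr rfl fun j _ => ?_
    rw [Matrix.vecMulVec_mulVec]
    simp [smul_dotProduct]
  rw [key, Matrix.mulVec_mulVec, Matrix.mul_nonsing_inv _ hdet, Matrix.one_mulVec]

/-- Split a linear predictor into the selected columns and the remaining ones. -/
lemma mulVec_eq_submatrix_mulVec_add {n d m : ℕ} (X : Matrix (Fin n) (Fin d) ℝ)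
    (κ : Fin m → Fin d) (hκ : Function.Injective κ) (β : Fin d → ℝ) :
    X.mulVec β = (X.submatrix id κ).mulVec (β ∘ κ)
      + X.mulVec fun j => if j ∈ Finset.univ.image κ then 0 else β j := by
  ext i
  have h : ∑ l, X i (κ l) * β (κ l) = ∑ j, if j ∈ Finset.univ.image κ then X i j * β j else 0 := by
    rw [← Finset.sum_filter, Finset.filter_mem_eq_inter, Finset.univ_inter,
      Finset.sum_image hκ.injOn]
  simp only [Pi.add_apply, Matrix.mulVec, dotProduct, Matrix.submatrix_apply, id,
    Function.comp_apply]
  rw [h, ← Finset.sum_add_distrib]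
  refine Finset.sum_congr rfl fun j _ => ?_
  split_ifs <;> simp

/-- The LOO-CV estimator as a quadratic form in the residual vector (LOO-CV part of Lemma 1):
the leave-one-out cross-validation estimator of a Bayesian normal linear regression submodel
equals `εᵀÃε + b̃ᵀε + c̃` with `Ã = -(1/(2τ²)) P̃ᵀD̃P̃`, `b̃ = -(1/τ²) P̃ᵀD̃P̃ ŷ` and explicit `c̃`. -/
theorem stmt10 (n d dk : ℕ) (X : Matrix (Fin n) (Fin d) ℝ)
    (κ : Fin dk → Fin d) (hκ : Function.Injective κ)
    (Xk : Matrix (Fin n) (Fin dk) ℝ) (hXk : Xk = X.submatrix id κ)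
    (G : Fin n → Matrix (Fin dk) (Fin dk) ℝ)
    (hG : ∀ i, G i = ∑ p ∈ Finset.univ.erase i, Matrix.vecMulVec (Xk p) (Xk p))
    (hpd : ∀ i, (G i).PosDef)
    (v : Fin n → Fin n → ℝ)
    (hv : ∀ i j, v i j = Xk j ⬝ᵥ (G i)⁻¹.mulVec (Xk i))
    (Pt : Matrix (Fin n) (Fin n) ℝ)
    (hPt : ∀ i j, Pt i j = if i = j then -1 else v i j)
    (Dt : Matrix (Fin n) (Fin n) ℝ)
    (hDt : Dt = Matrix.diagonal fun i => (v i i + 1)⁻¹)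
    (τ : ℝ) (hτ : 0 < τ) (β : Fin d → ℝ) (ε : Fin n → ℝ)
    (yhat : Fin n → ℝ)
    (hyhat : yhat = X.mulVec fun j => if j ∈ Finset.univ.image κ then 0 else β j)
    (y : Fin n → ℝ) (hy : y = X.mulVec β + ε) :
    (∑ i, (-(y i - ∑ j ∈ Finset.univ.erase i, v i j * y j) ^ 2
            / (2 * (v i i + 1) * τ ^ 2)
          - (1 / 2) * Real.log (2 * π * (v i i + 1) * τ ^ 2)))
      = ε ⬝ᵥ (-(1 / (2 * τ ^ 2)) • (Ptᵀ * Dt * Pt)).mulVec ε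
        + (-(1 / τ ^ 2) • (Ptᵀ * Dt * Pt).mulVec yhat) ⬝ᵥ ε
        + (-(1 / (2 * τ ^ 2)) * (yhat ⬝ᵥ (Ptᵀ * Dt * Pt).mulVec yhat)
            + (1 / 2) * ∑ i, Real.log (Dt i i)
            - ((n : ℝ) / 2) * Real.log (2 * π * τ ^ 2)) := by
  have hv_pos (i : Fin n) : 0 < v i i + 1 := by
    have h := (hpd i).inv.posSemidef.dotProduct_mulVec_nonneg (Xk i)
    rw [star_trivial, ← hv] at h
    linarith
  have hPt_mulVec (i : Fin n) (x : Fin n → ℝ) :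
      Pt.mulVec x i = ∑ j ∈ Finset.univ.erase i, v i j * x j - x i := by
    rw [Matrix.mulVec, dotProduct, ← Finset.add_sum_erase _ _ (Finset.mem_univ i), hPt,
      if_pos rfl, Finset.sum_congr rfl fun j hj => by
        rw [hPt, if_neg (Finset.ne_of_mem_erase hj).symm]]
    ring
  have hPt_fit (γ : Fin dk → ℝ) : Pt.mulVec (Xk.mulVec γ) = 0 := by
    ext i
    have h := sum_erase_leverage_mul_dotProduct Xk i (G i) (hG i)
      (hpd i).det_pos.ne'.isUnit γ
    simp only [← hv] at h
    rw [hPt_mulVec]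
    exact sub_eq_zero.mpr h
  have hPt_y : Pt.mulVec y = Pt.mulVec yhat + Pt.mulVec ε := by
    rw [hy, mulVec_eq_submatrix_mulVec_add X κ hκ β, ← hXk, ← hyhat, Matrix.mulVec_add,
      Matrix.mulVec_add, hPt_fit, zero_add]
  have hterm (i : Fin n) :
      -(y i - ∑ j ∈ Finset.univ.erase i, v i j * y j) ^ 2 / (2 * (v i i + 1) * τ ^ 2)
          - (1 / 2) * Real.log (2 * π * (v i i + 1) * τ ^ 2)
        = -(1 / (2 * τ ^ 2)) * ((v i i + 1)⁻¹ * (Pt.mulVec ε i * Pt.mulVec ε i))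
          + -(1 / τ ^ 2) * ((v i i + 1)⁻¹ * (Pt.mulVec ε i * Pt.mulVec yhat i))
          + -(1 / (2 * τ ^ 2)) * ((v i i + 1)⁻¹ * (Pt.mulVec yhat i * Pt.mulVec yhat i))
          + (1 / 2) * Real.log (v i i + 1)⁻¹ - (1 / 2) * Real.log (2 * π * τ ^ 2) := by
    have hvi := (hv_pos i).ne'
    have hres : y i - ∑ j ∈ Finset.univ.erase i, v i j * y j
        = -(Pt.mulVec yhat i + Pt.mulVec ε i) := by
      rw [← Pi.add_apply, ← hPt_y, hPt_mulVec]
      ring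
    have hlog : Real.log (2 * π * (v i i + 1) * τ ^ 2)
        = Real.log (2 * π * τ ^ 2) + Real.log (v i i + 1) := by
      rw [← Real.log_mul (by positivity) hvi]
      ring_nf
    rw [hres, hlog, Real.log_inv]
    field_simp
    ring
  rw [Finset.sum_congr rfl fun i _ => hterm i, smul_dotProduct,
    dotProduct_comm ((Ptᵀ * Dt * Pt).mulVec yhat) ε, Matrix.smul_mulVec, dotProduct_smul, hDt]
  simp only [dotProduct_transpose_mul_diagonal_mul_mulVec, Finset.sum_add_distrib,
    Finset.sum_sub_distrib, ← Finset.mul_sum, Matrix.diagonal_apply_eq, smul_eq_mul,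
    Finset.sum_const, Finset.card_univ, Fintype.card_fin, nsmul_eq_mul]
  ring
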